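/- Let A ∈ ℝ^{n×n} and C ∈ ℝ^{p×n}, and suppose the pair (C, A) is observable in the eigenvector (PBH) sense: for every λ ∈ ℂ and every nonzero v ∈ ℂⁿ with Av = λv, one has Cv ≠ 0. Let Ū ∈ ℝ^{n×r} satisfy ŪᵀŪ = I_r and ŪŪᵀAŪ = AŪ. Then the pair (CŪ, ŪᵀAŪ) is observable in the same sense: for every λ ∈ ℂ and every nonzero w ∈ ℂʳ with (ŪᵀAŪ)w = λw, one has (CŪ)w ≠ 0. -/

import Mathlib

open Matrix

theorem Matrix.map_ofReal_mul {l m n : Type*} [Fintype m]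
    (M : Matrix l m ℝ) (N : Matrix m n ℝ) :
    (M * N).map Complex.ofReal = M.map Complex.ofReal * N.map Complex.ofReal :=
  Matrix.map_mul (f := Complex.ofRealHom)

/-- **Proposition 5 (observability of the reduced pair).**
If `(C, A)` is observable in the PBH eigenvector sense and `Ū` is an
equilibrium point of the Oja flow (`ŪᵀŪ = I_r`, `ŪŪᵀAŪ = AŪ`), then the
reduced pair `(CŪ, ŪᵀAŪ)` is observable in the same sense. -/
theorem reduced_pair_observable
    {n r p : ℕ} (hrn : r ≤ n)
    (A : Matrix (Fin n) (Fin n) ℝ) (C : Matrix (Fin p) (Fin n) ℝ)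
    (hobs : ∀ (lam : ℂ) (v : Fin n → ℂ), v ≠ 0 →
      (A.map Complex.ofReal).mulVec v = lam • v →
      (C.map Complex.ofReal).mulVec v ≠ 0)
    (Ubar : Matrix (Fin n) (Fin r) ℝ)
    (hU : Ubarᵀ * Ubar = (1 : Matrix (Fin r) (Fin r) ℝ))
    (heq : Ubar * Ubarᵀ * A * Ubar = A * Ubar) :
    ∀ (lam : ℂ) (w : Fin r → ℂ), w ≠ 0 →
      ((Ubarᵀ * A * Ubar).map Complex.ofReal).mulVec w = lam • w →
      ((C * Ubar).map Complex.ofReal).mulVec w ≠ 0 := by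
  intro lam w hw hlam
  rw [map_ofReal_mul, ← mulVec_mulVec]
  refine hobs lam _ (fun h => hw ?_) ?_
  · have hone : (Ubarᵀ * Ubar).map Complex.ofReal = 1 := by
      rw [hU]
      exact Matrix.map_one _ Complex.ofReal_zero Complex.ofReal_one
    rw [← one_mulVec w, ← hone, map_ofReal_mul, ← mulVec_mulVec, h, mulVec_zero]
  · rw [mulVec_mulVec, ← map_ofReal_mul, ← heq, Matrix.mul_assoc, Matrix.mul_assoc,
      ← Matrix.mul_assoc Ubarᵀ, map_ofReal_mul, ← mulVec_mulVec, hlam, mulVec_smul]
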